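/- For all positive integers n ≤ 5000 and k with 2 ≤ k ≤ n/2, gcd(C(n,k), C(n−1,2)) > 1. -/

import Mathlib

/-- `allBelow p n` says that `p i` holds for every `i < n`; the recursor makes it cheap to evaluate
in the kernel. -/
def allBelow (p : ℕ → Bool) (n : ℕ) : Bool :=
  Nat.rec true (fun i ih => and (p i) ih) n

theorem of_allBelow {p : ℕ → Bool} {n : ℕ} (h : allBelow p n = true) {i : ℕ} (hi : i < n) :
    p i = true := by
  induction n with
  | zero => omega
  | succ n ih =>
    have h' : (p n && allBelow p n) = true := h
    rw [Bool.and_eq_true] at h'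
    rcases Nat.lt_succ_iff_lt_or_eq.mp hi with hi | rfl
    · exact ih h'.2 hi
    · exact h'.1

theorem two_dvd_pred_mul_self (k : ℕ) : 2 ∣ k * (k - 1) := by
  cases k with
  | zero => simp
  | succ k => simpa [mul_comm] using (Nat.even_mul_succ_self k).two_dvd

/-- If `c` is coprime to `m l / 2`, with `m` or `l` odd, then `m ∣ c T` implies `m ∣ T` for even
`T`. -/
theorem dvd_of_coprime_half_mul {m l T U c : ℕ} (hT : 2 ∣ T) (hml : m % 2 = 1 ∨ l % 2 = 1)
    (h : c * T = m * U) (hc : Nat.Coprime c (m * l / 2)) (hl : 2 ∣ m * l) : m ∣ T := by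
  obtain hm | ⟨r, rfl⟩ : m % 2 = 1 ∨ 2 ∣ m := by omega
  · have h2l : 2 ∣ l := (Nat.Coprime.dvd_mul_left
      ((Nat.coprime_two_left).2 (Nat.odd_iff.2 hm))).1 hl
    obtain ⟨s, rfl⟩ := h2l
    have e : m * (2 * s) / 2 = m * s := by
      rw [show m * (2 * s) = 2 * (m * s) by ring]; simp
    rw [e] at hc
    exact (Nat.Coprime.coprime_mul_right_right hc).symm.dvd_of_dvd_mul_left ⟨U, h⟩
  · have e : 2 * r * l / 2 = r * l := by
      rw [show 2 * r * l = 2 * (r * l) by ring]; simp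
    rw [e] at hc
    have hr : Nat.Coprime r c := (Nat.Coprime.coprime_mul_right_right hc).symm
    rcases Nat.mod_two_eq_zero_or_one r with h0 | h1
    · have h2c : Nat.Coprime 2 c := hr.coprime_dvd_left (Nat.dvd_of_mod_eq_zero h0)
      exact (h2c.mul_left hr).dvd_of_dvd_mul_left ⟨U, h⟩
    · have : r ∣ T := hr.dvd_of_dvd_mul_left ⟨2 * U, by rw [h]; ring⟩
      exact Nat.Coprime.mul_dvd_of_dvd_of_dvd
        ((Nat.coprime_two_left).2 (Nat.odd_iff.2 h1)) hT this

theorem choose_mul_two_falling (n k : ℕ) :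
    (n + 2).choose (k + 2) * ((k + 2) * (k + 1)) = (n + 2) * (n + 1) * n.choose k := by
  have h1 := Nat.add_one_mul_choose_eq (n + 1) (k + 1)
  have h2 := Nat.add_one_mul_choose_eq n k
  calc _ = (n + 2).choose (k + 2) * (k + 2) * (k + 1) := by ring
    _ = (n + 2) * ((n + 1).choose (k + 1) * (k + 1)) := by rw [← h1]; ring
    _ = _ := by rw [← h2]; ring

theorem choose_mul_three_falling (n k : ℕ) :
    (n + 3).choose (k + 3) * ((k + 3) * (k + 2) * (k + 1)) =
      (n + 3) * (n + 2) * (n + 1) * n.choose k := by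
  have h1 := Nat.add_one_mul_choose_eq (n + 2) (k + 2)
  have h2 := choose_mul_two_falling n k
  calc _ = (n + 3).choose (k + 3) * (k + 3) * ((k + 2) * (k + 1)) := by ring
    _ = (n + 3) * ((n + 2).choose (k + 2) * ((k + 2) * (k + 1))) := by rw [← h1]; ring
    _ = _ := by rw [h2]; ring

/-- Coprimality of `C(n, k)` and `C(n - 1, 2)` forces `n - 1 ∣ k (k - 1)`. -/
theorem pred_dvd_of_coprime {n k : ℕ} (hn : 2 ≤ n) (hk : 2 ≤ k)
    (hc : Nat.Coprime (n.choose k) ((n - 1).choose 2)) : n - 1 ∣ k * (k - 1) := by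
  obtain ⟨n, rfl⟩ := Nat.exists_eq_add_of_le' hn
  obtain ⟨k, rfl⟩ := Nat.exists_eq_add_of_le' hk
  rw [Nat.choose_two_right] at hc
  refine dvd_of_coprime_half_mul (two_dvd_pred_mul_self _) (l := n) ?_ (U := (n + 2) * n.choose k)
    ?_ hc ?_
  · omega
  · have := choose_mul_two_falling n k
    simp only [Nat.add_succ_sub_one] at this ⊢
    rw [this]; ring
  · exact two_dvd_pred_mul_self (n + 1)

/-- Coprimality of `C(n, k)` and `C(n - 1, 2)` forces `n - 2 ∣ k (k - 1) (k - 2)`. -/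
theorem pred_pred_dvd_of_coprime {n k : ℕ} (hn : 3 ≤ n) (hk : 3 ≤ k)
    (hc : Nat.Coprime (n.choose k) ((n - 1).choose 2)) : n - 2 ∣ k * (k - 1) * (k - 2) := by
  obtain ⟨n, rfl⟩ := Nat.exists_eq_add_of_le' hn
  obtain ⟨k, rfl⟩ := Nat.exists_eq_add_of_le' hk
  rw [Nat.choose_two_right, show n + 3 - 1 = n + 2 by omega, show n + 2 - 1 = n + 1 by omega,
    mul_comm] at hc
  refine dvd_of_coprime_half_mul ((two_dvd_pred_mul_self _).mul_right _) (l := n + 2) ?_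
    (U := (n + 3) * (n + 2) * n.choose k) ?_ hc ?_
  · omega
  · have := choose_mul_three_falling n k
    rw [show k + 3 - 1 = k + 2 by omega, show k + 3 - 2 = k + 1 by omega,
      show n + 3 - 2 = n + 1 by omega, this]
    ring
  · rw [mul_comm]; exact two_dvd_pred_mul_self (n + 2)

theorem two_dvd_choose_of_even_of_odd {n k : ℕ} (hn : n % 2 = 0) (hk : k % 2 = 1) :
    2 ∣ n.choose k := by
  obtain ⟨n, rfl⟩ | rfl : (∃ m, n = m + 1) ∨ n = 0 := by
    cases n <;> simp
  · obtain ⟨k, rfl⟩ : ∃ m, k = m + 1 := ⟨k - 1, by omega⟩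
    have h := Nat.add_one_mul_choose_eq n k
    have h2 : 2 ∣ (n + 1).choose (k + 1) * (k + 1) := h ▸ (Nat.dvd_of_mod_eq_zero hn).mul_right _
    exact (Nat.coprime_two_left.2 (Nat.odd_iff.2 hk)).dvd_of_dvd_mul_right h2
  · rw [Nat.choose_eq_zero_of_lt (by omega)]; simp

theorem three_dvd_choose_of_base_three_digits : 3 ∣ Nat.choose 3691 1395 := by
  have : Fact (Nat.Prime 3) := ⟨by norm_num⟩
  have step (n k : ℕ) (h : 3 ∣ (n / 3).choose (k / 3)) : 3 ∣ n.choose k :=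
    (Choose.choose_modEq_choose_mod_mul_choose_div_nat.dvd_iff (dvd_refl 3)).2 (h.mul_left _)
  iterate 4 apply step; norm_num
  exact (Choose.choose_modEq_choose_mod_mul_choose_div_nat.dvd_iff (dvd_refl 3)).2 (by simp)

/-- The test run for `k (k - 1) = m d`: either `d - 1 ∤ m (k - 2)`, or `d ≥ 5000`, or
`d + 1 ≡ 2 [MOD 4]` with `k` odd, or `(d + 1, k) = (3691, 1395)`. -/
def quotientTest (k m d : ℕ) : Bool :=
  or (not (Nat.beq (m * (k - 2) % (d - 1)) 0)) <| or (Nat.ble 5000 d) <|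
    or (and (Nat.beq (d % 4) 1) (Nat.beq (k % 2) 1)) (and (Nat.beq d 3690) (Nat.beq k 1395))

/-- `quotientTest` for `d = k (k - 1) / m`, passed vacuously when `m ∤ k (k - 1)`. -/
def pairTest (k m : ℕ) : Bool :=
  or (not (Nat.beq (k * (k - 1) % m) 0)) (quotientTest k m (k * (k - 1) / m))

/-- `pairTest k m` for all `m` with `k (k - 1) / 5000 < m ≤ (k - 1) / 2`. -/
def rowTest (k : ℕ) : Bool :=
  allBelow (fun j => pairTest k (k * (k - 1) / 5000 + 1 + j)) ((k - 1) / 2 - k * (k - 1) / 5000)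

theorem allBelow_rowTest : allBelow rowTest 2501 = true := by decide +kernel

theorem guo_conjecture_to_5000 (n k : ℕ) (hn : 0 < n) (hn' : n ≤ 5000)
    (h2 : 2 ≤ k) (hkn : k ≤ n / 2) :
    1 < Nat.gcd (n.choose k) ((n - 1).choose 2) := by
  by_contra hgcd
  have hpos : 0 < Nat.gcd (n.choose k) ((n - 1).choose 2) :=
    Nat.gcd_pos_of_pos_left _ (Nat.choose_pos (by omega))
  have hc : Nat.Coprime (n.choose k) ((n - 1).choose 2) := by
    unfold Nat.Coprime; omega
  obtain ⟨d, rfl⟩ : ∃ d, n = d + 1 := ⟨n - 1, by omega⟩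
  have hd : 2 * k - 1 ≤ d := by omega
  obtain ⟨m, hm⟩ := pred_dvd_of_coprime (by omega) h2 hc
  rw [Nat.add_sub_cancel] at hm
  have hk1 : 0 < k * (k - 1) := Nat.mul_pos (by omega) (by omega)
  have hm0 : 0 < m := Nat.pos_of_ne_zero (by rintro rfl; omega)
  have hmk : 2 * m < k := by
    obtain ⟨j, rfl⟩ := Nat.exists_eq_add_of_le' h2
    have hd' : 2 * j + 3 ≤ d := by omega
    have hm' : (j + 2) * (j + 1) = d * m := hm
    by_contra hlt
    nlinarith [Nat.mul_le_mul hd' (le_refl m)]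
  have hlow : k * (k - 1) / 5000 < m := by
    rw [Nat.div_lt_iff_lt_mul (by norm_num), hm, mul_comm d m]
    exact Nat.mul_lt_mul_of_pos_left (by omega) hm0
  have hdvd : d - 1 ∣ m * (k - 2) := by
    have h := pred_pred_dvd_of_coprime (by omega) (by omega) hc
    rw [hm, show d + 1 - 2 = d - 1 by omega, mul_assoc] at h
    refine Nat.Coprime.dvd_of_dvd_mul_left ?_ h
    have := Nat.coprime_self_add_right (m := d - 1) (n := 1)
    rw [Nat.sub_add_cancel (by omega)] at this
    exact this.2 (Nat.coprime_one_right _)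
  have hrow : rowTest k = true := of_allBelow allBelow_rowTest (by omega)
  have hpair := of_allBelow hrow (i := m - (k * (k - 1) / 5000 + 1)) (by omega)
  rw [Nat.add_sub_cancel' hlow] at hpair
  have hdiv : k * (k - 1) / m = d := by rw [hm]; exact Nat.mul_div_cancel _ hm0
  have hmod : k * (k - 1) % m = 0 := by rw [hm]; exact Nat.mul_mod_left _ _
  simp only [pairTest, quotientTest, hdiv, hmod, Nat.mod_eq_zero_of_dvd hdvd, Nat.beq_eq,
    Bool.or_eq_true, Bool.and_eq_true, Nat.ble_eq, Nat.beq_refl, Bool.not_true, Bool.false_eq_true,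
    false_or] at hpair
  rw [Nat.add_sub_cancel] at hc
  rcases hpair with h | ⟨hd4, hk⟩ | ⟨rfl, rfl⟩
  · omega
  · have hright : 2 ∣ d.choose 2 := by
      rw [Nat.choose_two_right]
      obtain ⟨r, rfl⟩ : ∃ r, d = 4 * r + 1 := ⟨d / 4, by omega⟩
      refine ⟨(4 * r + 1) * r, ?_⟩
      rw [Nat.add_sub_cancel, show (4 * r + 1) * (4 * r) = 2 * (2 * ((4 * r + 1) * r)) by ring]
      simp
    exact Nat.not_coprime_of_dvd_of_dvd (by norm_num)
      (two_dvd_choose_of_even_of_odd (by omega) hk) hright hc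
  · exact Nat.not_coprime_of_dvd_of_dvd (by norm_num) three_dvd_choose_of_base_three_digits
      (by rw [Nat.choose_two_right]; norm_num) hc
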